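/- arXiv:2505.12178 — 2 statements merged into one kernel-verified Lean document; each statement's English description precedes it below -/
import Mathlib

section
/- For any integer n ≥ 3 and any non-negative real numbers a_1, …, a_n, equality holds in the inequality (1/n!) ∑_{π ∈ S_n} ∏_{i: π(i)=i} a_i ≥ (1/C(n,2)) ∑_{1 ≤ i < j ≤ n} √(a_i a_j) if and only if a_i = 1 for all 1 ≤ i ≤ n. -/
open Finset

section FPM
variable {ι : Type*} [DecidableEq ι]

noncomputable def fpN (s : Finset ι) (a : ι → ℝ) : ℝ :=
  ∑ T ∈ s.powerset, ((s.card - T.card).factorial : ℝ) * ∏ i ∈ T, (a i - 1)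

noncomputable def fpK (s : Finset ι) (a : ι → ℝ) : ℝ :=
  ∑ T ∈ s.powerset, ((s.card - T.card : ℕ) : ℝ) *
    (((s.card - T.card).factorial : ℝ) * ∏ i ∈ T, (a i - 1))

def fpE (s : Finset ι) (x : ι → ℝ) : ℝ := (∑ i ∈ s, x i) ^ 2 - ∑ i ∈ s, x i ^ 2

lemma fp_sum_erase (r : Finset ι) (f : Finset ι → ℝ) :
    ∑ j ∈ r, ∑ T ∈ (r.erase j).powerset, f T
      = ∑ T ∈ r.powerset, ((r.card - T.card : ℕ) : ℝ) * f T := by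
  rw [Finset.sum_comm' (t' := r.powerset) (s' := fun T => r \ T)]
  · apply Finset.sum_congr rfl
    intro T hT
    rw [Finset.sum_const, Finset.card_sdiff_of_subset (Finset.mem_powerset.1 hT), nsmul_eq_mul]
  · intro j T
    simp only [Finset.mem_powerset, Finset.mem_sdiff, Finset.subset_erase]
    tauto

lemma fpN_update (r : Finset ι) (a : ι → ℝ) (j : ι) (hj : j ∈ r) :
    fpN r (Function.update a j 1) =
      ∑ T ∈ (r.erase j).powerset, ((r.card - T.card).factorial : ℝ) * ∏ i ∈ T, (a i - 1) := by
  unfold fpN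
  symm
  have hsub : (r.erase j).powerset ⊆ r.powerset :=
    Finset.powerset_mono.2 (Finset.erase_subset _ _)
  rw [← Finset.sum_subset hsub]
  · apply Finset.sum_congr rfl
    intro T hT
    congr 1
    apply Finset.prod_congr rfl
    intro i hi
    have : i ≠ j := by
      have := (Finset.mem_powerset.1 hT) hi
      exact (Finset.mem_erase.1 this).1
    rw [Function.update_of_ne this]
  · intro T hT hT'
    have hjT : j ∈ T := by
      by_contra h
      exact hT' (by
        rw [Finset.mem_powerset, Finset.subset_erase]
        exact ⟨Finset.mem_powerset.1 hT, h⟩)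
    rw [Finset.prod_eq_zero hjT (by simp), mul_zero]

lemma fpK_eq (r : Finset ι) (a : ι → ℝ) :
    fpK r a = ∑ j ∈ r, fpN r (Function.update a j 1) := by
  rw [Finset.sum_congr rfl (fun j hj => fpN_update r a j hj), fp_sum_erase, fpK]

lemma fpN_insert (i : ι) (r : Finset ι) (hi : i ∉ r) (a : ι → ℝ) :
    fpN (insert i r) a = a i * fpN r a + fpK r a := by
  unfold fpN fpK
  rw [Finset.sum_powerset_insert hi, Finset.mul_sum, ← Finset.sum_add_distrib,
    ← Finset.sum_add_distrib]
  apply Finset.sum_congr rfl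
  intro T hT
  have hTr := Finset.mem_powerset.1 hT
  have hiT : i ∉ T := fun h => hi (hTr h)
  have hc := Finset.card_le_card hTr
  rw [Finset.card_insert_of_notMem hi, Finset.card_insert_of_notMem hiT,
    Finset.prod_insert hiT]
  obtain ⟨d, hd⟩ := Nat.exists_eq_add_of_le hc
  have h1 : r.card + 1 - T.card = d + 1 := by omega
  have h2 : r.card + 1 - (T.card + 1) = d := by omega
  have h3 : r.card - T.card = d := by omega
  rw [h1, h2, h3, Nat.factorial_succ]
  push_cast
  ring

lemma fpN_congr (r : Finset ι) (a b : ι → ℝ) (h : ∀ i ∈ r, a i = b i) : fpN r a = fpN r b := by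
  unfold fpN
  apply Finset.sum_congr rfl
  intro T hT
  congr 1
  apply Finset.prod_congr rfl
  intro i hi
  rw [h i (Finset.mem_powerset.1 hT hi)]

lemma fpK_congr (r : Finset ι) (a b : ι → ℝ) (h : ∀ i ∈ r, a i = b i) : fpK r a = fpK r b := by
  unfold fpK
  apply Finset.sum_congr rfl
  intro T hT
  congr 2
  apply Finset.prod_congr rfl
  intro i hi
  rw [h i (Finset.mem_powerset.1 hT hi)]

lemma fpN_rec (s : Finset ι) (a : ι → ℝ) :
    fpN s a = ∑ i ∈ s, fpN (s.erase i) a + ∏ i ∈ s, (a i - 1) := by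
  have h : ∑ i ∈ s, fpN (s.erase i) a = ∑ i ∈ s, ∑ T ∈ (s.erase i).powerset,
      ((s.card - 1 - T.card).factorial : ℝ) * ∏ i ∈ T, (a i - 1) := by
    apply Finset.sum_congr rfl
    intro i hi
    rw [fpN, Finset.card_erase_of_mem hi]
  rw [h, fp_sum_erase, fpN]
  have hs : s ∈ s.powerset := Finset.mem_powerset_self s
  rw [← Finset.sum_erase_add _ _ hs, ← Finset.sum_erase_add s.powerset _ hs]
  simp only [Nat.sub_self, Nat.factorial_zero, Nat.cast_one, one_mul, Nat.cast_zero, zero_mul,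
    add_zero]
  congr 1
  apply Finset.sum_congr rfl
  intro T hT
  rw [Finset.mem_erase, Finset.mem_powerset] at hT
  have hlt : T.card < s.card := Finset.card_lt_card (lt_of_le_of_ne hT.2 hT.1)
  obtain ⟨d, hd⟩ := Nat.exists_eq_add_of_lt hlt
  have h1 : s.card - T.card = d + 1 := by omega
  have h2 : s.card - 1 - T.card = d := by omega
  rw [h1, h2, Nat.factorial_succ]
  push_cast
  ring

lemma fpN_empty (a : ι → ℝ) : fpN ∅ a = 1 := by simp [fpN]
lemma fpK_empty (a : ι → ℝ) : fpK ∅ a = 0 := by simp [fpK]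

lemma fp_update_nonneg (a : ι → ℝ) (ha : ∀ i, 0 ≤ a i) (j : ι) (c : ℝ) (hc : 0 ≤ c) :
    ∀ i, 0 ≤ Function.update a j c i := by
  intro i
  by_cases h : i = j
  · subst h; simpa
  · rw [Function.update_of_ne h]; exact ha i

lemma fpK_as_N (i : ι) (r : Finset ι) (hi : i ∉ r) (a : ι → ℝ) :
    fpK r a = fpN (insert i r) (Function.update a i 0) := by
  rw [fpN_insert i r hi]
  simp only [Function.update_self, zero_mul, zero_add]
  apply fpK_congr
  intro k hk
  rw [Function.update_of_ne]
  rintro rfl; exact hi hk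

lemma fpN_ge (n : ℕ) : ∀ s : Finset ι, s.card = n → ∀ a : ι → ℝ, (∀ i, 0 ≤ a i) →
    (numDerangements n : ℝ) ≤ fpN s a := by
  induction n using Nat.strong_induction_on with
  | _ n ih =>
    match n, ih with
    | 0, _ =>
      intro s hs a ha
      rw [Finset.card_eq_zero] at hs
      subst hs
      simp [fpN_empty]
    | 1, _ =>
      intro s hs a ha
      obtain ⟨i, rfl⟩ := Finset.card_eq_one.1 hs
      have := fpN_insert i ∅ (by simp) a
      rw [fpN_empty, fpK_empty] at this
      simp at this
      simp [this, ha i]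
    | n+2, ih =>
      intro s hs a ha
      obtain ⟨i, r, hi, rfl, hr⟩ := Finset.card_eq_succ.1 hs
      rw [fpN_insert i r hi, fpK_eq]
      have h0 : 0 ≤ a i * fpN r a :=
        mul_nonneg (ha i) (le_trans (Nat.cast_nonneg _) (ih (n+1) (by omega) r hr a ha))
      have h1 : ∀ j ∈ r, ((numDerangements n + numDerangements (n+1) : ℕ) : ℝ) ≤
          fpN r (Function.update a j 1) := by
        intro j hj
        have hj' : j ∉ r.erase j := by simp
        have hins : insert j (r.erase j) = r := Finset.insert_erase hj
        have hce : (r.erase j).card = n := by rw [Finset.card_erase_of_mem hj, hr]; rfl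
        have e1 : fpN r (Function.update a j 1) =
            fpN (r.erase j) (Function.update a j 1) +
            fpN r (Function.update (Function.update a j 1) j 0) := by
          have := fpN_insert j (r.erase j) hj' (Function.update a j 1)
          have h2 := fpK_as_N j (r.erase j) hj' (Function.update a j 1)
          rw [hins] at this h2
          rw [this, h2]; simp
        rw [e1]
        push_cast
        have hu := fp_update_nonneg a ha j 1 zero_le_one
        exact add_le_add (ih n (by omega) _ hce _ hu)
          (ih (n+1) (by omega) r hr _ (fp_update_nonneg _ hu j 0 le_rfl))
      have h2 := Finset.sum_le_sum h1
      rw [Finset.sum_const, hr, nsmul_eq_mul] at h2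
      rw [numDerangements_add_two]
      push_cast at h2 ⊢
      linarith

lemma fp_der (k : ℕ) : (k+2).factorial ≤ 3 * numDerangements (k+2) ∧
    (k+3).factorial ≤ 3 * numDerangements (k+3) := by
  induction k with
  | zero => decide
  | succ k ih =>
    refine ⟨ih.2, ?_⟩
    have := numDerangements_add_two (k+2)
    rw [show k + 1 + 3 = k + 2 + 2 by ring, this, Nat.factorial_succ (k+3),
      Nat.factorial_succ (k+2)]
    have h1 := ih.1
    have h2 := ih.2
    rw [Nat.factorial_succ (k+2)] at h2
    have e : (k+2+1) * (k+2).factorial + (k+2).factorial ≤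
      3 * (numDerangements (k+2) + numDerangements (k+2+1)) := by
      have : k + 3 = k+2+1 := rfl
      rw [this] at h2
      omega
    calc _ = (k+2+1) * ((k+2+1) * (k+2).factorial + (k+2).factorial) := by ring
      _ ≤ (k+2+1) * (3 * (numDerangements (k+2) + numDerangements (k+2+1))) :=
        Nat.mul_le_mul_left _ e
      _ = _ := by ring

lemma fpE_insert (i : ι) (r : Finset ι) (hi : i ∉ r) (x : ι → ℝ) :
    fpE (insert i r) x = fpE r x + 2 * x i * ∑ j ∈ r, x j := by
  unfold fpE
  rw [Finset.sum_insert hi, Finset.sum_insert hi]; ring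

lemma fpE_erase (i : ι) (r : Finset ι) (hi : i ∈ r) (x : ι → ℝ) :
    fpE (r.erase i) x = fpE r x - 2 * x i * (∑ j ∈ r, x j) + 2 * x i ^ 2 := by
  unfold fpE
  rw [Finset.sum_erase_eq_sub hi, Finset.sum_erase_eq_sub hi]; ring

lemma fpE_erase_sum (r : Finset ι) (x : ι → ℝ) :
    ∑ i ∈ r, fpE (r.erase i) x = (r.card - 2) * fpE r x := by
  rw [Finset.sum_congr rfl (fun i hi => fpE_erase i r hi x)]
  rw [Finset.sum_add_distrib, Finset.sum_sub_distrib, ← Finset.mul_sum, ← Finset.sum_mul,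
    ← Finset.mul_sum, Finset.sum_const, nsmul_eq_mul]
  unfold fpE
  ring

lemma fpE_update (i : ι) (r : Finset ι) (hi : i ∈ r) (x : ι → ℝ) :
    fpE r (Function.update x i 1) = fpE (r.erase i) x + 2 * (∑ j ∈ r, x j - x i) := by
  have hi' : i ∉ r.erase i := by simp
  have hc : ∀ k ∈ r.erase i, Function.update x i 1 k = x k := by
    intro k hk
    rw [Function.update_of_ne (Finset.mem_erase.1 hk).1]
  have h1 : fpE (r.erase i) (Function.update x i 1) = fpE (r.erase i) x := by
    unfold fpE
    have h2 : ∑ k ∈ r.erase i, Function.update x i 1 k ^ 2 = ∑ k ∈ r.erase i, x k ^ 2 :=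
      Finset.sum_congr rfl (fun k hk => by rw [hc k hk])
    rw [Finset.sum_congr rfl hc, h2]
  have := fpE_insert i (r.erase i) hi' (Function.update x i 1)
  rw [Finset.insert_erase hi, h1, Finset.sum_congr rfl hc, Finset.sum_erase_eq_sub hi] at this
  rw [this]; simp

lemma fpE_update_sum (r : Finset ι) (x : ι → ℝ) :
    ∑ i ∈ r, fpE r (Function.update x i 1) =
      (r.card - 2) * fpE r x + 2 * (r.card - 1) * ∑ j ∈ r, x j := by
  rw [Finset.sum_congr rfl (fun i hi => fpE_update i r hi x), Finset.sum_add_distrib,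
    fpE_erase_sum, ← Finset.mul_sum, Finset.sum_sub_distrib, Finset.sum_const, nsmul_eq_mul]
  ring

lemma fpE_nonneg (r : Finset ι) (x : ι → ℝ) (hx : ∀ i, 0 ≤ x i) : 0 ≤ fpE r x := by
  induction r using Finset.induction_on with
  | empty => simp [fpE]
  | insert i r hi ih =>
    rw [fpE_insert i r hi]
    have := Finset.sum_nonneg (s := r) (fun j _ => hx j)
    have := mul_nonneg (hx i) this
    linarith

/-- direct expansion on three points -/
lemma fp_three (i j k : ι) (hij : i ≠ j) (hik : i ≠ k) (hjk : j ≠ k) (a : ι → ℝ) :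
    fpN {i, j, k} a = 2 + a i + a j + a k + a i * a j * a k := by
  have h1 : ∀ (i : ι) (a : ι → ℝ), fpN {i} a = a i := by
    intro i a
    have := fpN_insert i ∅ (by simp) a
    rw [fpN_empty, fpK_empty] at this
    simpa using this
  have h2 : ∀ (i j : ι) (a : ι → ℝ), i ≠ j → fpN {i, j} a = 1 + a i * a j := by
    intro i j a h
    have := fpN_insert i {j} (by simpa using h) a
    rw [this, fpK_eq, Finset.sum_singleton, h1, h1]
    simp; ring
  have := fpN_insert i {j, k} (by simp [hij, hik]) a
  rw [this, fpK_eq, Finset.sum_pair hjk, h2 _ _ _ hjk, h2 _ _ _ hjk, h2 _ _ _ hjk]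
  simp [Function.update_of_ne hjk, Function.update_of_ne hjk.symm]
  ring

lemma fp_ineq3 (x y z : ℝ) (hx : 0 ≤ x) (hy : 0 ≤ y) (hz : 0 ≤ z) :
    2 * (x*y+y*z+z*x) ≤ 2 + x^2+y^2+z^2+x^2*y^2*z^2 ∧
    (2 * (x*y+y*z+z*x) = 2 + x^2+y^2+z^2+x^2*y^2*z^2 → x = 1 ∧ y = 1 ∧ z = 1) := by
  have key : ∀ x y z : ℝ, 0 ≤ z → 0 ≤ (x-1)*(y-1) →
      2 * (x*y+y*z+z*x) ≤ 2 + x^2+y^2+z^2+x^2*y^2*z^2 ∧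
      (2 * (x*y+y*z+z*x) = 2 + x^2+y^2+z^2+x^2*y^2*z^2 → x = 1 ∧ y = 1 ∧ z = 1) := by
    intro x y z hz h
    have h1 := mul_nonneg hz h
    have h2 := sq_nonneg (x*y*z-1)
    have h3 := sq_nonneg (x-y)
    have h4 := sq_nonneg (z-1)
    refine ⟨by nlinarith, fun he => ?_⟩
    have e3 : (x-y)^2 = 0 := by nlinarith
    have e4 : (z-1)^2 = 0 := by nlinarith
    have e1 : z*((x-1)*(y-1)) = 0 := by nlinarith
    have e3' : x = y := by have := pow_eq_zero_iff (two_ne_zero) |>.1 e3; linarith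
    have e4' : z = 1 := by have := pow_eq_zero_iff (two_ne_zero) |>.1 e4; linarith
    subst e3' e4'
    have : x - 1 = 0 := by
      have : (x-1)*(x-1) = 0 := by linarith
      exact mul_self_eq_zero.1 this
    have : x = 1 := by linarith
    exact ⟨this, this, rfl⟩
  by_cases c1 : 0 ≤ (x-1)*(y-1)
  · exact key x y z hz c1
  by_cases c2 : 0 ≤ (y-1)*(z-1)
  · have := key y z x hx c2
    refine ⟨by linarith [this.1], fun h => ?_⟩
    have := this.2 (by linarith)
    tauto
  by_cases c3 : 0 ≤ (z-1)*(x-1)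
  · have := key z x y hy c3
    refine ⟨by linarith [this.1], fun h => ?_⟩
    have := this.2 (by linarith)
    tauto
  exfalso
  push Not at c1 c2 c3
  have h12 := mul_pos_of_neg_of_neg c1 c2
  have h123 := mul_neg_of_pos_of_neg h12 c3
  nlinarith [sq_nonneg ((x-1)*(y-1)*(z-1))]

def fpP (ι : Type*) [DecidableEq ι] (n : ℕ) : Prop :=
  ∀ s : Finset ι, s.card = n + 3 → ∀ x : ι → ℝ, (∀ i, 0 ≤ x i) →
    ((n+1).factorial : ℝ) * fpE s x ≤ fpN s (fun i => x i ^ 2) ∧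
    (((n+1).factorial : ℝ) * fpE s x = fpN s (fun i => x i ^ 2) → ∀ i ∈ s, x i = 1)

lemma fpP_zero : fpP ι 0 := by
  intro s hs x hx
  obtain ⟨i, j, k, hij, hik, hjk, rfl⟩ := Finset.card_eq_three.1 hs
  rw [fp_three i j k hij hik hjk]
  have hE : fpE {i, j, k} x = 2 * (x i * x j + x j * x k + x k * x i) := by
    unfold fpE
    have hi : i ∉ ({j, k} : Finset ι) := by simp [hij, hik]
    rw [Finset.sum_insert hi, Finset.sum_insert hi, Finset.sum_pair hjk, Finset.sum_pair hjk]
    ring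
  have h := fp_ineq3 (x i) (x j) (x k) (hx i) (hx j) (hx k)
  rw [hE]
  simp only [zero_add, Nat.factorial_one, Nat.cast_one, one_mul]
  refine ⟨h.1, fun he => ?_⟩
  have := h.2 he
  simp only [Finset.mem_insert, Finset.mem_singleton]
  rintro l (rfl | rfl | rfl) <;> tauto

lemma fp_sq_update (x : ι → ℝ) (j : ι) :
    Function.update (fun i => x i ^ 2) j 1 = fun i => (Function.update x j 1 i) ^ 2 := by
  funext i
  by_cases h : i = j
  · subst h; simp
  · simp [Function.update_of_ne h]

/-- step when the product is nonnegative -/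
lemma fp_step_pos (n : ℕ) (ih : fpP ι n) (s : Finset ι) (hs : s.card = n + 4) (x : ι → ℝ)
    (hx : ∀ i, 0 ≤ x i) (hp : 0 ≤ ∏ i ∈ s, (x i ^ 2 - 1)) :
    ((n+2).factorial : ℝ) * fpE s x ≤ fpN s (fun i => x i ^ 2) ∧
    (((n+2).factorial : ℝ) * fpE s x = fpN s (fun i => x i ^ 2) → ∀ i ∈ s, x i = 1) := by
  have hc : ∀ i ∈ s, (s.erase i).card = n + 3 := by
    intro i hi
    rw [Finset.card_erase_of_mem hi, hs]; rfl
  have h1 : ∀ i ∈ s, ((n+1).factorial : ℝ) * fpE (s.erase i) x ≤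
      fpN (s.erase i) (fun i => x i ^ 2) := fun i hi => (ih _ (hc i hi) x hx).1
  have hE : ∑ i ∈ s, ((n+1).factorial : ℝ) * fpE (s.erase i) x
      = ((n+2).factorial : ℝ) * fpE s x := by
    rw [← Finset.mul_sum, fpE_erase_sum, hs, Nat.factorial_succ (n+1)]
    push_cast; ring
  have h2 := Finset.sum_le_sum h1
  rw [hE] at h2
  have hN := fpN_rec s (fun i => x i ^ 2)
  refine ⟨by linarith, fun he => ?_⟩
  have h3 : ∑ i ∈ s, ((n+1).factorial : ℝ) * fpE (s.erase i) x
      = ∑ i ∈ s, fpN (s.erase i) (fun i => x i ^ 2) := by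
    rw [hE]; linarith
  rw [Finset.sum_eq_sum_iff_of_le h1] at h3
  intro i hi
  obtain ⟨j, hj, hji⟩ := Finset.exists_mem_ne (by omega : 1 < s.card) i
  exact (ih _ (hc j hj) x hx).2 (h3 j hj) i (Finset.mem_erase.2 ⟨hji.symm, hi⟩)

/-- step by removing a point -/
lemma fp_step_i (n : ℕ) (ih : fpP ι n) (i : ι) (r : Finset ι) (hi : i ∉ r)
    (hr : r.card = n + 3) (x : ι → ℝ) (hx : ∀ i, 0 ≤ x i)
    (hp : ∀ j ∈ r, x j ≠ 1)
    (hq : 0 ≤ (1 - x i) * (2 * (n + 2) * ∑ j ∈ r, x j - (1 + x i) * fpE r x)) :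
    ((n+2).factorial : ℝ) * fpE (insert i r) x < fpN (insert i r) (fun i => x i ^ 2) := by
  rw [fpN_insert i r hi, fpK_eq, fpE_insert i r hi]
  have h0 := mul_le_mul_of_nonneg_left (ih r hr x hx).1 (sq_nonneg (x i))
  have h1 : ∀ j ∈ r, ((n+1).factorial : ℝ) * fpE r (Function.update x j 1) <
      fpN r (Function.update (fun i => x i ^ 2) j 1) := by
    intro j hj
    rw [fp_sq_update]
    have := ih r hr _ (fp_update_nonneg x hx j 1 zero_le_one)
    refine lt_of_le_of_ne this.1 (fun he => ?_)
    obtain ⟨k, hk, hkj⟩ := Finset.exists_mem_ne (by omega : 1 < r.card) j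
    have := this.2 he k hk
    rw [Function.update_of_ne hkj] at this
    exact hp k hk this
  have hne : r.Nonempty := Finset.card_pos.1 (by omega)
  have h2 := Finset.sum_lt_sum_of_nonempty hne h1
  rw [← Finset.mul_sum, fpE_update_sum, hr] at h2
  rw [Nat.factorial_succ (n+1)]
  have hf : (0:ℝ) < ((n+1).factorial : ℝ) := by positivity
  have h3 := mul_nonneg hf.le hq
  push_cast at h2 ⊢
  nlinarith

/-- consequence for a pair -/
lemma fp_pair (n : ℕ) (l g : ι) (R : Finset ι) (hlg : l ≠ g) (hl : l ∉ R) (hg : g ∉ R) (x : ι → ℝ)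
    (h1 : x l < 1) (h2 : 1 < x g)
    (hql : (1 - x l) * (2 * (n + 2) * ∑ j ∈ insert g R, x j - (1 + x l) * fpE (insert g R) x) < 0)
    (hqg : (1 - x g) * (2 * (n + 2) * ∑ j ∈ insert l R, x j - (1 + x g) * fpE (insert l R) x) < 0) :
    2 * (n + 2) < 2 * ∑ j ∈ R, x j - fpE R x := by
  rw [fpE_insert g R hg, Finset.sum_insert hg] at hql
  rw [fpE_insert l R hl, Finset.sum_insert hl] at hqg
  set σ := ∑ j ∈ R, x j
  set e := fpE R x
  have a1 : 2 * (n + 2) * (x g + σ) - (1 + x l) * (e + 2 * x g * σ) < 0 := by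
    by_contra h
    push Not at h
    have := mul_nonneg (by linarith : 0 ≤ 1 - x l) h
    linarith
  have a2 : 0 < 2 * (n + 2) * (x l + σ) - (1 + x g) * (e + 2 * x l * σ) := by
    by_contra h
    push Not at h
    have := mul_nonneg_of_nonpos_of_nonpos (by linarith : 1 - x g ≤ 0) h
    linarith
  have a3 : 0 < (x g - x l) * (2 * σ - e - 2 * (n + 2)) := by nlinarith
  have := (mul_pos_iff_of_pos_left (by linarith : 0 < x g - x l)).1 a3
  linarith

/-- the direct estimate -/
lemma fp_direct (k : ℕ) (g h : ι) (L : Finset ι) (hgh : g ≠ h) (hg : g ∉ L) (hh : h ∉ L)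
    (hL : L.card = k + 3) (x : ι → ℝ) (hx : ∀ i, 0 ≤ x i) (g3 : 3 < x g) (h3 : 3 < x h)
    (hW : ∑ j ∈ L, x j < 2) :
    ((k+3).factorial : ℝ) * fpE (insert g (insert h L)) x <
      fpN (insert g (insert h L)) (fun i => x i ^ 2) := by
  have hg' : g ∉ insert h L := by simp [hgh, hg]
  have hh' : h ∉ insert g L := by simp [hgh.symm, hh]
  set a : ι → ℝ := fun i => x i ^ 2 with ha
  have han : ∀ i, 0 ≤ a i := fun i => sq_nonneg _
  have hD1 : ((k+3).factorial : ℝ) ≤ 3 * (numDerangements (k+3) : ℝ) := by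
    exact_mod_cast (fp_der k).2
  have hD2 : ((k+4).factorial : ℝ) ≤ 3 * (numDerangements (k+4) : ℝ) := by
    exact_mod_cast (fp_der (k+1)).2
  have n1 := fpN_insert g (insert h L) hg' a
  have n2 := fpN_insert h L hh a
  have n3 := fpK_as_N h L hh a
  have n4 := fpK_as_N g (insert h L) hg' a
  have n5 := fpN_insert h (insert g L) hh' (Function.update a g 0)
  rw [Finset.insert_comm h g] at n5
  have b1 := fpN_ge (k+3) L hL a han
  have hc1 : (insert h L).card = k + 4 := by rw [Finset.card_insert_of_notMem hh, hL]
  have hc2 : (insert g L).card = k + 4 := by rw [Finset.card_insert_of_notMem hg, hL]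
  have hag := fp_update_nonneg a han g 0 le_rfl
  have b2 := fpN_ge (k+4) (insert h L) hc1 _ (fp_update_nonneg a han h 0 le_rfl)
  have b3 := fpN_ge (k+4) (insert g L) hc2 _ hag
  have b4 : 0 ≤ fpK (insert g L) (Function.update a g 0) := by
    rw [fpK_eq]
    refine Finset.sum_nonneg (fun j hj => le_trans (Nat.cast_nonneg _)
      (fpN_ge (k+4) (insert g L) hc2 _ (fp_update_nonneg _ hag j 1 zero_le_one)))
  rw [Function.update_of_ne hgh.symm] at n5
  have hE : fpE L x ≤ (∑ j ∈ L, x j) ^ 2 := by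
    unfold fpE
    have := Finset.sum_nonneg (s := L) (fun j _ => sq_nonneg (x j))
    linarith
  have hW0 : 0 ≤ ∑ j ∈ L, x j := Finset.sum_nonneg (fun j _ => hx j)
  rw [fpE_insert g _ hg', fpE_insert h _ hh, Finset.sum_insert hh]
  rw [n1, n4, n5, n2, n3]
  set W := ∑ j ∈ L, x j
  set f : ℝ := ((k+3).factorial : ℝ) with hf
  have hf0 : 0 < f := by positivity
  have hD2' : 4 * f ≤ 3 * (numDerangements (k+4) : ℝ) := by
    refine le_trans ?_ hD2
    rw [Nat.factorial_succ (k+3)]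
    push_cast
    have : (0:ℝ) ≤ k := Nat.cast_nonneg k
    nlinarith
  have hag : a g = x g ^ 2 := rfl
  have hah : a h = x h ^ 2 := rfl
  rw [hag, hah]
  set G := x g
  set H := x h
  have c1 : f ≤ 3 * fpN L a := by linarith
  have c2 : 4 * f ≤ 3 * fpN (insert h L) (Function.update a h 0) := by linarith
  have c3 : 4 * f ≤ 3 * fpN (insert g L) (Function.update a g 0) := by linarith
  have d1 := mul_le_mul_of_nonneg_left c1 (by positivity : 0 ≤ G^2 * H^2)
  have d2 := mul_le_mul_of_nonneg_left c2 (by positivity : 0 ≤ G^2)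
  have d3 := mul_le_mul_of_nonneg_left c3 (by positivity : 0 ≤ H^2)
  have hW2 : W^2 ≤ 4 := by nlinarith
  have key : 3 * (fpE L x + 2 * H * W + 2 * G * (H + W)) < G^2*H^2 + 4*G^2 + 4*H^2 := by
    have e1 : H * W ≤ 2 * H := by nlinarith
    have e2 : G * W ≤ 2 * G := by nlinarith
    have e3 : 9 ≤ G * H := by nlinarith
    have e4 : 0 ≤ (G * H - 9) * (G * H) := mul_nonneg (by linarith) (by linarith)
    have e5 : 0 ≤ G * (G - 3) := mul_nonneg (by linarith) (by linarith)
    have e6 : 0 ≤ H * (H - 3) := mul_nonneg (by linarith) (by linarith)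
    ring_nf at e1 e2 e3 e4 e5 e6 ⊢
    linarith
  have := mul_lt_mul_of_pos_left key hf0
  ring_nf at this d1 d2 d3 b4 ⊢
  linarith

/-- the hard case -/
lemma fp_hard (n : ℕ) (s : Finset ι) (hs : s.card = n + 4) (x : ι → ℝ)
    (hx : ∀ i, 0 ≤ x i) (hp : ∏ i ∈ s, (x i ^ 2 - 1) < 0)
    (hq : ∀ i ∈ s, (1 - x i) * (2 * (n + 2) * ∑ j ∈ s.erase i, x j
      - (1 + x i) * fpE (s.erase i) x) < 0) :
    ((n+2).factorial : ℝ) * fpE s x < fpN s (fun i => x i ^ 2) := by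
  have hne : ∀ i ∈ s, x i ≠ 1 := by
    intro i hi h
    rw [Finset.prod_eq_zero hi (by rw [h]; norm_num)] at hp
    exact lt_irrefl _ hp
  have hn0 : (0:ℝ) ≤ n := Nat.cast_nonneg n
  -- some l below 1
  obtain ⟨l, hl, hl1⟩ : ∃ l ∈ s, x l < 1 := by
    by_contra hcon
    push Not at hcon
    have : 0 ≤ ∏ i ∈ s, (x i ^ 2 - 1) := by
      refine Finset.prod_nonneg (fun i hi => ?_)
      nlinarith [hcon i hi]
    linarith
  -- some g above 1
  obtain ⟨g, hg, hg1⟩ : ∃ g ∈ s, 1 < x g := by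
    by_contra hcon
    push Not at hcon
    have h1 := hq l hl
    have hE : fpE (s.erase l) x ≤ (n + 2) * ∑ j ∈ s.erase l, x j := by
      have e : fpE (s.erase l) x = ∑ j ∈ s.erase l, x j * ∑ k ∈ (s.erase l).erase j, x k := by
        rw [Finset.sum_congr rfl (fun j hj => by
          rw [Finset.sum_erase_eq_sub hj, mul_sub] )]
        rw [Finset.sum_sub_distrib, ← Finset.sum_mul]
        unfold fpE
        simp only [sq]
      rw [e, Finset.mul_sum]
      refine Finset.sum_le_sum (fun j hj => ?_)
      rw [mul_comm]
      refine mul_le_mul_of_nonneg_right ?_ (hx j)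
      have := Finset.sum_le_card_nsmul ((s.erase l).erase j) x 1 (fun k hk =>
        hcon k (Finset.mem_of_mem_erase (Finset.mem_of_mem_erase hk)))
      rw [Finset.card_erase_of_mem hj, Finset.card_erase_of_mem hl, hs] at this
      simpa using this
    have hE0 := fpE_nonneg (s.erase l) x hx
    have : 0 ≤ (1 - x l) * (2 * (n + 2) * ∑ j ∈ s.erase l, x j
      - (1 + x l) * fpE (s.erase l) x) := by
      refine mul_nonneg (by linarith) ?_
      nlinarith
    linarith
  -- pair inequality
  have pair : ∀ g' ∈ s, 1 < x g' → 2 * ((n:ℝ) + 2) <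
      2 * ∑ j ∈ (s.erase l).erase g', x j - fpE ((s.erase l).erase g') x := by
    intro g' hg' h1
    have hlg : l ≠ g' := by rintro rfl; linarith
    have i1 : insert g' ((s.erase l).erase g') = s.erase l :=
      Finset.insert_erase (Finset.mem_erase.2 ⟨hlg.symm, hg'⟩)
    have i2 : insert l ((s.erase l).erase g') = s.erase g' := by
      rw [Finset.erase_right_comm]
      exact Finset.insert_erase (Finset.mem_erase.2 ⟨hlg, hl⟩)
    apply fp_pair n l g' _ hlg (by simp) (by simp) x hl1 h1
    · rw [i1]; exact hq l hl
    · rw [i2]; exact hq g' hg'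
  have hlg : l ≠ g := by rintro rfl; linarith
  have pg := pair g hg hg1
  set R := (s.erase l).erase g with hR
  have hRc : R.card = n + 2 := by
    rw [hR, Finset.card_erase_of_mem (Finset.mem_erase.2 ⟨hlg.symm, hg⟩),
      Finset.card_erase_of_mem hl, hs]; rfl
  obtain ⟨h, hhR, hh1⟩ : ∃ h ∈ R, 1 < x h := by
    by_contra hcon
    push Not at hcon
    have := Finset.sum_le_card_nsmul R x 1 hcon
    rw [hRc] at this
    have h2 := fpE_nonneg R x hx
    simp at this
    linarith
  have hhg : h ≠ g := (Finset.mem_erase.1 hhR).1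
  have hhl : h ≠ l := (Finset.mem_erase.1 (Finset.mem_erase.1 hhR).2).1
  have hhs : h ∈ s := (Finset.mem_erase.1 (Finset.mem_erase.1 hhR).2).2
  set Q := R.erase h with hQ
  have hQc : Q.card = n + 1 := by rw [hQ, Finset.card_erase_of_mem hhR, hRc]; rfl
  have hRi : insert h Q = R := Finset.insert_erase hhR
  have hhQ : h ∉ Q := by simp [hQ]
  have hgQ : g ∉ Q := by simp [hQ, hR]
  have hlQ : l ∉ Q := by simp [hQ, hR]
  have hQ1 : ∀ v ∈ Q, x v < 1 := by
    intro v hv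
    by_contra hcon
    push Not at hcon
    have hvi : insert v (Q.erase v) = Q := Finset.insert_erase hv
    have hv' : v ∉ Q.erase v := by simp
    rw [← hRi, fpE_insert h Q hhQ, Finset.sum_insert hhQ, ← hvi, fpE_insert v _ hv',
      Finset.sum_insert hv'] at pg
    have e0 := fpE_nonneg (Q.erase v) x hx
    have s0 := Finset.sum_nonneg (s := Q.erase v) (fun j _ => hx j)
    nlinarith [mul_nonneg (by linarith : 0 ≤ x h - 1) (by linarith : 0 ≤ x v - 1),
      mul_nonneg s0 (by linarith : 0 ≤ x h - 1), mul_nonneg s0 (by linarith : 0 ≤ x v - 1)]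
  have hQsum : ∑ j ∈ Q, x j ≤ n + 1 := by
    have := Finset.sum_le_card_nsmul Q x 1 (fun k hk => (hQ1 k hk).le)
    rw [hQc] at this
    simpa using this
  have hQ0 : 0 ≤ ∑ j ∈ Q, x j := Finset.sum_nonneg (fun j _ => hx j)
  have hEQ := fpE_nonneg Q x hx
  have pg' := pg
  rw [← hRi, fpE_insert h Q hhQ, Finset.sum_insert hhQ] at pg'
  have ph := pair h hhs hh1
  have hR2 : (s.erase l).erase h = insert g Q := by
    rw [hQ, hR, Finset.erase_right_comm (a := g) (b := h)]
    exact (Finset.insert_erase (Finset.mem_erase.2 ⟨hhg.symm, Finset.mem_erase.2 ⟨hlg.symm, hg⟩⟩)).symm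
  rw [hR2, fpE_insert g Q hgQ, Finset.sum_insert hgQ] at ph
  set q := ∑ j ∈ Q, x j with hq'
  have hq1 : q < 1 := by
    by_contra hcon
    push Not at hcon
    nlinarith
  have hhn : (n:ℝ) + 2 < x h := by nlinarith
  have hgn : (n:ℝ) + 2 < x g := by nlinarith
  have hsi : insert g (insert h (insert l Q)) = s := by
    rw [Finset.insert_comm h l, hRi, Finset.insert_comm, hR,
      Finset.insert_erase (Finset.mem_erase.2 ⟨hlg.symm, hg⟩), Finset.insert_erase hl]
  match n with
  | 0 =>
    exfalso
    obtain ⟨v, hv⟩ := Finset.card_eq_one.1 hQc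
    have hv1 : x v < 1 := hQ1 v (by simp [hv])
    rw [← hsi, Finset.prod_insert (by simp [hhg.symm, hlg.symm, hgQ]),
      Finset.prod_insert (by simp [hhl, hhQ]), Finset.prod_insert hlQ, hv,
      Finset.prod_singleton] at hp
    have a1 : 0 < x g ^ 2 - 1 := by nlinarith
    have a2 : 0 < x h ^ 2 - 1 := by nlinarith
    have a3 : 0 < 1 - x l ^ 2 := by nlinarith [hx l]
    have a4 : 0 < 1 - x v ^ 2 := by nlinarith [hx v]
    have := mul_pos (mul_pos a1 a2) (mul_pos a3 a4)
    nlinarith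
  | k + 1 =>
    have hk : (0:ℝ) ≤ k := Nat.cast_nonneg k
    push_cast at hhn hgn
    have := fp_direct k g h (insert l Q) hhg.symm (by simp [hlg.symm, hgQ]) (by simp [hhl, hhQ])
      (by rw [Finset.card_insert_of_notMem hlQ, hQc]) x hx (by linarith) (by linarith)
      (by rw [Finset.sum_insert hlQ]; linarith)
    rw [hsi] at this
    exact this

lemma fp_main (n : ℕ) : fpP ι n := by
  induction n with
  | zero => exact fpP_zero
  | succ n ih =>
    intro s hs x hx
    by_cases hp : 0 ≤ ∏ i ∈ s, (x i ^ 2 - 1)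
    · exact fp_step_pos n ih s hs x hx hp
    push Not at hp
    have hlt : ((n+2).factorial : ℝ) * fpE s x < fpN s (fun i => x i ^ 2) := by
      by_cases hq : ∀ i ∈ s, (1 - x i) * (2 * (n + 2) * ∑ j ∈ s.erase i, x j
        - (1 + x i) * fpE (s.erase i) x) < 0
      · exact fp_hard n s hs x hx hp hq
      push Not at hq
      obtain ⟨i, hi, hqi⟩ := hq
      have := fp_step_i n ih i (s.erase i) (by simp)
        (by rw [Finset.card_erase_of_mem hi, hs]; rfl) x hx (by
          intro j hj h
          rw [Finset.prod_eq_zero (Finset.mem_of_mem_erase hj) (by rw [h]; norm_num)] at hp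
          exact lt_irrefl _ hp) hqi
      rwa [Finset.insert_erase hi] at this
    exact ⟨hlt.le, fun he => absurd he hlt.ne⟩

lemma fp_card_fix {n : ℕ} (T : Finset (Fin n)) :
    (Finset.univ.filter (fun π : Equiv.Perm (Fin n) => ∀ i ∈ T, π i = i)).card
      = (n - T.card).factorial := by
  have e := Equiv.Perm.subtypeEquivSubtypePerm (fun i : Fin n => i ∉ T)
  have h := Fintype.card_congr e
  rw [Fintype.card_perm] at h
  have h1 : Fintype.card {i : Fin n // i ∉ T} = n - T.card := by
    rw [Fintype.card_subtype_compl]; simp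
  rw [h1] at h
  rw [h, Fintype.card_subtype]
  congr 1
  ext π
  simp

lemma fp_perm_sum {n : ℕ} (a : Fin n → ℝ) :
    ∑ π : Equiv.Perm (Fin n), ∏ i ∈ Finset.univ.filter (fun i => π i = i), a i
      = fpN Finset.univ a := by
  have h : ∀ π : Equiv.Perm (Fin n), ∏ i ∈ Finset.univ.filter (fun i => π i = i), a i
      = ∑ T ∈ (Finset.univ : Finset (Fin n)).powerset,
        if (∀ i ∈ T, π i = i) then ∏ i ∈ T, (a i - 1) else 0 := by
    intro π
    have : ∀ i, a i = (a i - 1) + 1 := fun i => by ring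
    rw [Finset.prod_congr rfl (fun i _ => this i), Finset.prod_add_one, ← Finset.sum_filter]
    apply Finset.sum_congr _ (fun _ _ => rfl)
    ext T
    simp [Finset.subset_iff]
  rw [Finset.sum_congr rfl (fun π _ => h π), Finset.sum_comm, fpN]
  apply Finset.sum_congr rfl
  intro T _
  rw [← Finset.sum_filter, Finset.sum_const, fp_card_fix, nsmul_eq_mul]
  simp

lemma fp_pairs_sum {n : ℕ} (a : Fin n → ℝ) (ha : ∀ i, 0 ≤ a i) :
    2 * ∑ S ∈ (Finset.univ : Finset (Fin n)).powersetCard 2, Real.sqrt (∏ i ∈ S, a i)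
      = fpE Finset.univ (fun i => Real.sqrt (a i)) := by
  have h : ∀ s : Finset (Fin n), 2 * ∑ S ∈ s.powersetCard 2, Real.sqrt (∏ i ∈ S, a i)
      = fpE s (fun i => Real.sqrt (a i)) := by
    intro s
    induction s using Finset.induction_on with
    | empty => 
      rw [Finset.powersetCard_eq_empty.2 (by simp)]; simp [fpE]
    | insert i r hi ih =>
      rw [fpE_insert i r hi, ← ih, Finset.powersetCard_succ_insert hi, Finset.sum_union,
        Finset.sum_image, Finset.powersetCard_one, Finset.sum_map]
      · rw [mul_add, mul_assoc 2, Finset.mul_sum r _ (Real.sqrt (a i))]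
        congr 2
        apply Finset.sum_congr rfl
        intro j hj
        have : i ≠ j := by rintro rfl; exact hi hj
        simp [Finset.prod_pair this, Real.sqrt_mul (ha i)]
      · intro S hS T hT hST
        have h1 : i ∉ S := fun h => hi ((Finset.mem_powersetCard.1 hS).1 h)
        have h2 : i ∉ T := fun h => hi ((Finset.mem_powersetCard.1 hT).1 h)
        have := congrArg (fun U => Finset.erase U i) hST
        simpa [Finset.erase_insert h1, Finset.erase_insert h2] using this
      · rw [Finset.disjoint_left]
        intro S hS hS'
        obtain ⟨T, _, rfl⟩ := Finset.mem_image.1 hS'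
        exact hi ((Finset.mem_powersetCard.1 hS).1 (Finset.mem_insert_self i T))
  exact h _

end FPM

/-- For any integer `n ≥ 3` and non-negative reals `a_1, …, a_n`,
equality holds in the fixed-point-measure inequality if and only if `a_i = 1` for all `i`. -/
theorem fixed_point_measure_eq_iff (n : ℕ) (hn : 3 ≤ n) (a : Fin n → ℝ)
    (ha : ∀ i, 0 ≤ a i) :
    (1 / (n.factorial : ℝ)) *
        ∑ π : Equiv.Perm (Fin n), ∏ i ∈ Finset.univ.filter (fun i => π i = i), a i =
      (1 / (n.choose 2 : ℝ)) *
        ∑ S ∈ (Finset.univ : Finset (Fin n)).powersetCard 2, Real.sqrt (∏ i ∈ S, a i) ↔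
    ∀ i, a i = 1 := by

  obtain ⟨k, rfl⟩ : ∃ k, n = k + 3 := ⟨n - 3, by omega⟩
  rw [fp_perm_sum]
  have hE := fp_pairs_sum a ha
  have hsq : (fun i => Real.sqrt (a i) ^ 2) = a := funext fun i => Real.sq_sqrt (ha i)
  have hm := fp_main (ι := Fin (k+3)) k Finset.univ (by simp) (fun i => Real.sqrt (a i))
    (fun i => Real.sqrt_nonneg _)
  simp only [hsq] at hm
  set P := ∑ S ∈ (Finset.univ : Finset (Fin (k+3))).powersetCard 2, Real.sqrt (∏ i ∈ S, a i)
  have hf : (0:ℝ) < ((k+1).factorial : ℝ) := by positivity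
  have hk : (0:ℝ) ≤ k := Nat.cast_nonneg k
  have hfac : ((k+3).factorial : ℝ) = (k+3) * (k+2) * ((k+1).factorial : ℝ) := by
    rw [Nat.factorial_succ (k+2), Nat.factorial_succ (k+1)]
    push_cast; ring
  have hch : (((k+3).choose 2 : ℕ) : ℝ) = (k+3) * (k+2) / 2 := by
    rw [Nat.cast_choose_two]; push_cast; ring
  constructor
  · intro h i
    have he : ((k+1).factorial : ℝ) * fpE Finset.univ (fun i => Real.sqrt (a i))
        = fpN Finset.univ a := by
      rw [← hE]
      rw [hfac, hch] at h
      field_simp at h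
      linarith
    have := hm.2 he i (Finset.mem_univ i)
    exact Real.sqrt_eq_one.1 this
  · intro h
    have h1 : fpN Finset.univ a = ((k+3).factorial : ℝ) := by
      rw [← fp_perm_sum]
      simp [h, Fintype.card_perm]
    have h2 : P = (((k+3).choose 2 : ℕ) : ℝ) := by
      simp [P, h]
    rw [h1, h2]
    have : (((k+3).choose 2 : ℕ) : ℝ) ≠ 0 := by rw [hch]; positivity
    have : ((k+3).factorial : ℝ) ≠ 0 := by positivity
    field_simp
end

section
/- Let n ≥ 4 be an integer, let k be an integer with ⌊n/2⌋ ≤ k ≤ n−2, and let x = (x_1, …, x_n) satisfy 0 < x_1 ≤ x_2 ≤ ⋯ ≤ x_n with x_k < x_{k+1} = x_{k+2} = ⋯ = x_n and x_n ≥ 1. Then S_k(x) > 0. -/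
open Finset

/-- The `k`-th elementary symmetric polynomial `e_k(x)` in `n` variables. -/
noncomputable def Efun (n : ℕ) (k : ℕ) (x : Fin n → ℝ) : ℝ :=
  ∑ S ∈ (Finset.univ : Finset (Fin n)).powersetCard k, ∏ i ∈ S, x i

/-- `L_n(x) = (1/n!) ∑_{k=0}^n c_{n-k} e_k(x)`, where `c_j = numDerangements j`. -/
noncomputable def Lfun (n : ℕ) (x : Fin n → ℝ) : ℝ :=
  (1 / (n.factorial : ℝ)) *
    ∑ k ∈ Finset.range (n + 1), (numDerangements (n - k) : ℝ) * Efun n k x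

/-- `R_n(x) = (1/C(n,2)) ∑_{i<j} √(x_i x_j)`. -/
noncomputable def Rfun (n : ℕ) (x : Fin n → ℝ) : ℝ :=
  (1 / (n.choose 2 : ℝ)) *
    ∑ S ∈ (Finset.univ : Finset (Fin n)).powersetCard 2, Real.sqrt (∏ i ∈ S, x i)

/-- `f_n(x) = L_n(x) - R_n(x)`. -/
noncomputable def ffun (n : ℕ) (x : Fin n → ℝ) : ℝ := Lfun n x - Rfun n x

/-- `S_k(x) = ∑_{i=1}^{n-2} c_{n-i} e_{i-1}(x̂_{k,l}) − (n-2)! ∑_{i ≠ k,l} √x_i/(√x_k + √x_l)`,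
where `x̂_{k,l}` is `x` with the `k`-th and `l`-th coordinates removed (here `l` plays the role
of the last index `n`, and `e_{i-1}` is expressed by summing over subsets of `[n] \ {k, l}`). -/
noncomputable def Sfun (n : ℕ) (k l : Fin n) (x : Fin n → ℝ) : ℝ :=
  (∑ i ∈ Finset.Icc 1 (n - 2), (numDerangements (n - i) : ℝ) *
      ∑ S ∈ ((Finset.univ.erase k).erase l).powersetCard (i - 1), ∏ j ∈ S, x j)
    - ((n - 2).factorial : ℝ) *
        ∑ i ∈ (Finset.univ.erase k).erase l,
          Real.sqrt (x i) / (Real.sqrt (x k) + Real.sqrt (x l))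


noncomputable def FF {ι : Type*} [DecidableEq ι] (U : Finset ι) (w : ι → ℝ) (a : ℕ) : ℝ :=
  ∑ T ∈ U.powerset, (numDerangements (a + (U.card - T.card)) : ℝ) * ∏ i ∈ T, w i

lemma FF_empty {ι : Type*} [DecidableEq ι] (w : ι → ℝ) (a : ℕ) :
    FF ∅ w a = numDerangements a := by simp [FF]

lemma FF_insert {ι : Type*} [DecidableEq ι] (U : Finset ι) (u : ι) (hu : u ∉ U) (w : ι → ℝ)
    (a : ℕ) : FF (insert u U) w a = FF U w (a + 1) + w u * FF U w a := by
  unfold FF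
  rw [Finset.sum_powerset_insert hu, Finset.mul_sum]
  congr 1
  · apply Finset.sum_congr rfl
    intro T hT
    have h := Finset.card_le_card (Finset.mem_powerset.1 hT)
    rw [Finset.card_insert_of_notMem hu]
    congr 3
    omega
  · apply Finset.sum_congr rfl
    intro T hT
    have hT' := Finset.mem_powerset.1 hT
    have hT2 : u ∉ T := fun h => hu (hT' h)
    rw [Finset.card_insert_of_notMem hu, Finset.card_insert_of_notMem hT2,
      Finset.prod_insert hT2, Nat.add_sub_add_right]
    ring

lemma FF_nonneg {ι : Type*} [DecidableEq ι] (U : Finset ι) (w : ι → ℝ) (hw : ∀ i ∈ U, 0 ≤ w i)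
    (a : ℕ) : 0 ≤ FF U w a := by
  unfold FF
  refine Finset.sum_nonneg fun T hT => mul_nonneg (Nat.cast_nonneg _) ?_
  exact Finset.prod_nonneg fun i hi => hw i (Finset.mem_powerset.1 hT hi)

lemma FF_mono {ι : Type*} [DecidableEq ι] (U : Finset ι) (w x : ι → ℝ)
    (hw : ∀ i ∈ U, 0 ≤ w i) (hx : ∀ i ∈ U, w i ≤ x i) (a : ℕ) : FF U w a ≤ FF U x a := by
  unfold FF
  refine Finset.sum_le_sum fun T hT => mul_le_mul_of_nonneg_left ?_ (Nat.cast_nonneg _)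
  exact Finset.prod_le_prod (fun i hi => hw i (Finset.mem_powerset.1 hT hi))
    (fun i hi => hx i (Finset.mem_powerset.1 hT hi))

lemma FF_congr {ι : Type*} [DecidableEq ι] (U : Finset ι) (w x : ι → ℝ)
    (hx : ∀ i ∈ U, w i = x i) (a : ℕ) : FF U w a = FF U x a := by
  unfold FF
  refine Finset.sum_congr rfl fun T hT => ?_
  rw [Finset.prod_congr rfl (fun i hi => hx i (Finset.mem_powerset.1 hT hi))]

lemma FF_rec {ι : Type*} [DecidableEq ι] (U : Finset ι) (w : ι → ℝ) :
    (∀ i ∈ U, 0 ≤ w i) → (∀ i ∈ U, w i ≤ 1) → 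
    (FF U w 1 ≥ U.card * FF U w 0) ∧
    ∀ a : ℕ, FF U w (a + 2) ≥ (a + 1 + U.card) * FF U w (a + 1) + (a + 1) * FF U w a := by
  induction U using Finset.induction_on with
  | empty =>
    intro _ _
    refine ⟨by simp [FF_empty], fun a => ?_⟩
    simp only [FF_empty, numDerangements_add_two]
    push_cast
    simp
    linarith
  | insert u U hu ih =>
    intro h0 h1
    have h0' : ∀ i ∈ U, 0 ≤ w i := fun i hi => h0 i (Finset.mem_insert_of_mem hi)
    have h1' : ∀ i ∈ U, w i ≤ 1 := fun i hi => h1 i (Finset.mem_insert_of_mem hi)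
    obtain ⟨ihA, ihB⟩ := ih h0' h1'
    have hu0 := h0 u (Finset.mem_insert_self _ _)
    have hu1 := h1 u (Finset.mem_insert_self _ _)
    have nn := fun a => FF_nonneg U w h0' a
    simp only [FF_insert U u hu, Finset.card_insert_of_notMem hu]
    push_cast
    constructor
    · have := ihB 0
      norm_num at this ⊢
      have e1 := mul_nonneg (sub_nonneg.2 hu1) (nn 0)
      have e2 := mul_le_mul_of_nonneg_left ihA hu0
      nlinarith
    · intro a
      have i1 := ihB (a + 1)
      have i2 := mul_le_mul_of_nonneg_left (ihB a) hu0
      have e1 := mul_nonneg (sub_nonneg.2 hu1) (nn (a + 1))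
      push_cast at i1
      simp only [add_assoc] at i1 i2 e1 ⊢
      norm_num at i1 i2 e1 ⊢
      nlinarith

lemma FF_one {ι : Type*} [DecidableEq ι] (U : Finset ι) :
    (U.card.factorial : ℝ) ≤ FF U (fun _ => 1) 0 := by
  induction U using Finset.induction_on with
  | empty => simp [FF_empty]
  | insert u U hu ih =>
    rw [FF_insert U u hu, Finset.card_insert_of_notMem hu, Nat.factorial_succ]
    have := (FF_rec U (fun _ => 1) (by simp) (by simp)).1
    push_cast
    nlinarith [(Nat.cast_nonneg U.card : (0:ℝ) ≤ U.card)]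

lemma exp_aux (N z : ℝ) (hN : 0 < N) (h0 : 0 ≤ z) (h1 : z ≤ 1) :
    Real.exp (-(z / N)) ≤ 1 - z / (N + 1) := by
  rw [Real.exp_neg, inv_le_comm₀ (Real.exp_pos _)]
  · refine le_trans ?_ (Real.add_one_le_exp _)
    rw [inv_le_iff_one_le_mul₀]
    · have : (z / N + 1) * (1 - z / (N + 1)) = 1 + z * (1 - z) / (N * (N + 1)) := by
        field_simp; ring
      rw [this]
      have : 0 ≤ z * (1 - z) / (N * (N + 1)) := by
        apply div_nonneg (mul_nonneg h0 (by linarith)); positivity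
      linarith
    · rw [sub_pos, div_lt_one (by linarith)]; linarith
  · rw [sub_pos, div_lt_one (by linarith)]; linarith

lemma FF_step {ι : Type*} [DecidableEq ι] (U : Finset ι) (u : ι) (hu : u ∈ U) (w : ι → ℝ)
    (h0 : ∀ i ∈ U, 0 ≤ w i) (h1 : ∀ i ∈ U, w i ≤ 1) :
    Real.exp (-((1 - w u) / U.card)) * FF U (Function.update w u 1) 1 ≤ FF U w 1 := by
  obtain ⟨V, hV, rfl⟩ : ∃ V, u ∉ V ∧ insert u V = U :=
    ⟨U.erase u, Finset.notMem_erase _ _, Finset.insert_erase hu⟩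
  have h0' : ∀ i ∈ V, 0 ≤ w i := fun i hi => h0 i (Finset.mem_insert_of_mem hi)
  have h1' : ∀ i ∈ V, w i ≤ 1 := fun i hi => h1 i (Finset.mem_insert_of_mem hi)
  have hc : ∀ a, FF V (Function.update w u 1) a = FF V w a := fun a =>
    FF_congr _ _ _ (fun i hi => Function.update_of_ne (by rintro rfl; exact hV hi) _ _) a
  rw [FF_insert V u hV, FF_insert V u hV, hc, hc, Function.update_self,
    Finset.card_insert_of_notMem hV]
  push_cast
  have r := (FF_rec V w h0' h1').2 0
  have n0 := FF_nonneg V w h0' 0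
  have n1 := FF_nonneg V w h0' 1
  have n2 := FF_nonneg V w h0' 2
  have hN : (0:ℝ) < V.card + 1 := by positivity
  have e := exp_aux (V.card + 1) (1 - w u) hN (by linarith [h1 u hu]) (by linarith [h0 u hu])
  norm_num at r ⊢
  refine (mul_le_mul_of_nonneg_right e (by linarith)).trans ?_
  have hz : 0 ≤ 1 - w u := by linarith [h1 u hu]
  have : FF V w 1 ≤ (FF V w 2 + FF V w 1) / (V.card + 1 + 1) := by
    rw [le_div_iff₀ (by linarith)]; nlinarith
  have := mul_le_mul_of_nonneg_left this hz
  have e3 : (1 - (1 - w u) / ((V.card:ℝ) + 1 + 1)) * (FF V w 2 + FF V w 1)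
      = (FF V w 2 + FF V w 1) - (1 - w u) * ((FF V w 2 + FF V w 1) / (V.card + 1 + 1)) := by
    ring
  rw [e3]; linarith

lemma FF_steps {ι : Type*} [DecidableEq ι] (U V : Finset ι) (w : ι → ℝ) :
    V ⊆ U → (∀ i ∈ U, 0 ≤ w i) → (∀ i ∈ U, w i ≤ 1) →
    Real.exp (-((∑ i ∈ V, (1 - w i)) / U.card)) * FF U (fun i => if i ∈ V then 1 else w i) 1
      ≤ FF U w 1 := by
  intro hVU h0 h1
  induction V using Finset.induction_on with
  | empty => simp
  | insert u V hu ih =>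
    have hV : V ⊆ U := fun i hi => hVU (Finset.mem_insert_of_mem hi)
    refine le_trans ?_ (ih hV)
    rw [Finset.sum_insert hu, add_div, add_comm, neg_add, Real.exp_add, mul_assoc]
    apply mul_le_mul_of_nonneg_left _ (Real.exp_pos _).le
    have := FF_step U u (hVU (Finset.mem_insert_self _ _)) (fun i => if i ∈ V then 1 else w i)
      (fun i hi => by split_ifs; exacts [zero_le_one, h0 i hi])
      (fun i hi => by split_ifs; exacts [le_refl _, h1 i hi])
    simp only [hu, if_false] at this
    have hf : (fun i => if i ∈ insert u V then 1 else w i)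
        = Function.update (fun i => if i ∈ V then 1 else w i) u 1 := by
      funext i
      by_cases hi : i = u
      · subst hi; simp
      · simp [hi, Function.update_of_ne]
    rw [hf]
    exact this

lemma FF_lower {ι : Type*} [DecidableEq ι] (U : Finset ι) (w : ι → ℝ)
    (h0 : ∀ i ∈ U, 0 ≤ w i) (h1 : ∀ i ∈ U, w i ≤ 1) :
    (U.card.factorial : ℝ) * (U.card * Real.exp (-((∑ i ∈ U, (1 - w i)) / U.card)))
      ≤ FF U w 1 := by
  refine le_trans ?_ (FF_steps U U w (fun _ h => h) h0 h1)
  rw [FF_congr U (fun i => if i ∈ U then 1 else w i) (fun _ => 1) (fun i hi => by simp [hi])]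
  have a := (FF_rec U (fun _ => 1) (by simp) (by simp)).1
  have b := FF_one U
  have : (U.card.factorial : ℝ) * U.card ≤ FF U (fun _ => 1) 1 := by
    nlinarith [(Nat.cast_nonneg U.card : (0:ℝ) ≤ U.card)]
  nlinarith [Real.exp_pos (-((∑ i ∈ U, (1 - w i)) / U.card))]

lemma exp_half : (0.6 : ℝ) ≤ Real.exp (-(1/2)) := by
  have h := Real.exp_one_lt_d9
  have h2 : Real.exp (-(1/2)) * Real.exp (-(1/2)) * Real.exp 1 = 1 := by
    rw [← Real.exp_add, ← Real.exp_add]; norm_num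
  have h3 := Real.exp_pos (-(1/2))
  by_contra hc
  push Not at hc
  have : Real.exp (-(1/2)) * Real.exp (-(1/2)) ≤ 0.36 := by nlinarith
  nlinarith [Real.exp_pos 1]

lemma final_ineq (m K g s t Q : ℝ) (hm : 0 ≤ m) (hK : 0 < K) (hg : 0 < g) (hgs : g ≤ s)
    (hs : s ≤ 1) (ht : 1 ≤ t) (hQ : K * g ^ 2 ≤ Q) :
    (m * t + K * g) / (s + t) < (m + K) * Real.exp (-((K - Q) / (m + K))) := by
  have hN : 0 < m + K := by linarith
  have hKg : 0 < K * g := mul_pos hK hg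
  have hn : 0 ≤ m * t + K * g := by nlinarith
  have h1 : (m * t + K * g) / (s + t) ≤ (m * t + K * g) / (g + t) :=
    div_le_div_of_nonneg_left hn (by linarith) (by linarith)
  refine lt_of_le_of_lt h1 ?_
  have hexp : Real.exp (-((K - K * g ^ 2) / (m + K))) ≤ Real.exp (-((K - Q) / (m + K))) := by
    apply Real.exp_le_exp.2
    apply neg_le_neg
    apply div_le_div_of_nonneg_right _ hN.le
    linarith
  refine lt_of_lt_of_le ?_ (mul_le_mul_of_nonneg_left hexp hN.le)
  set y := (K - K * g ^ 2) / (m + K) with hy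
  have hyN : (m + K) * y = K - K * g ^ 2 := by rw [hy]; field_simp
  rcases le_total K m with h | h
  · have : (m * t + K * g) / (g + t) ≤ m := by
      rw [div_le_iff₀ (by linarith)]; nlinarith
    have e := mul_le_mul_of_nonneg_left (Real.add_one_le_exp (-y)) hN.le
    nlinarith [mul_pos hKg hg]
  · have : (m * t + K * g) / (g + t) ≤ (m + K * g) / (1 + g) := by
      rw [div_le_div_iff₀ (by linarith) (by linarith)]
      nlinarith [mul_nonneg hg.le (mul_nonneg (sub_nonneg.2 h) (sub_nonneg.2 ht))]
    refine lt_of_le_of_lt this ?_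
    have e : 0.6 * (3 / 2 - y) ≤ Real.exp (-y) := by
      have e1 : Real.exp (-y) = Real.exp (-(1/2)) * Real.exp (1/2 - y) := by
        rw [← Real.exp_add]; congr 1; ring
      have e2 := Real.add_one_le_exp (1/2 - y)
      have e3 := exp_half
      have : y ≤ 1 := by
        rw [hy, div_le_one hN]; nlinarith [mul_pos hKg hg]
      rw [e1]
      apply mul_le_mul e3 (by linarith) (by linarith) (Real.exp_pos _).le
    refine lt_of_lt_of_le ?_ (mul_le_mul_of_nonneg_left e hN.le)
    have e4 : (m + K) * (0.6 * (3 / 2 - y)) = 0.6 * (3 / 2 * (m + K) - (K - K * g ^ 2)) := by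
      rw [← hyN]; ring
    rw [e4, div_lt_iff₀ (by linarith)]
    -- linear in m between 0 and K
    have q0 : 0 < 0.3 - 0.7 * g + 0.6 * g ^ 2 + 0.6 * g ^ 3 := by
      nlinarith [sq_nonneg (g - 7/12), pow_pos hg 3]
    have q1 : 0 < (0.2 + 0.6 * g ^ 2) * (1 + g) := by positivity
    have p0 := mul_nonneg (sub_nonneg.2 h) q0.le
    have p1 := mul_nonneg hm q1.le
    rcases hm.eq_or_lt with h' | h'
    · subst h'; nlinarith [mul_pos hK q0]
    · nlinarith [mul_pos h' q1]

lemma Sfun_eq (n : ℕ) (hn : 4 ≤ n) (k l : Fin n) (hkl : k ≠ l) (x : Fin n → ℝ) :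
    Sfun n k l x = FF ((Finset.univ.erase k).erase l) x 1 - ((n - 2).factorial : ℝ) *
        ∑ i ∈ (Finset.univ.erase k).erase l,
          Real.sqrt (x i) / (Real.sqrt (x k) + Real.sqrt (x l)) := by
  unfold Sfun
  congr 1
  have hc : ((Finset.univ.erase k).erase l).card = n - 2 := by
    rw [Finset.card_erase_of_mem (by simp [hkl.symm]), Finset.card_erase_of_mem (by simp)]
    simp; omega
  generalize ((Finset.univ.erase k).erase l) = U at hc
  unfold FF
  rw [Finset.sum_powerset, hc, Finset.sum_range_succ]
  obtain ⟨N, rfl⟩ : ∃ N, n = N + 2 := ⟨n - 2, by omega⟩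
  have hz : ∑ T ∈ Finset.powersetCard (N + 2 - 2) U,
      (numDerangements (1 + (N + 2 - 2 - T.card)) : ℝ) * ∏ i ∈ T, x i = 0 := by
    apply Finset.sum_eq_zero
    intro T hT
    rw [(Finset.mem_powersetCard.1 hT).2]
    simp
  rw [hz, add_zero, Finset.range_eq_Ico, ← Finset.Ico_add_one_right_eq_Icc,
    Finset.sum_Ico_eq_sum_range, ← Finset.range_eq_Ico]
  simp only [Nat.add_sub_cancel]
  apply Finset.sum_congr rfl
  intro j hj
  have hj' := Finset.mem_range.1 hj
  rw [Finset.mul_sum, Nat.add_sub_cancel_left]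
  apply Finset.sum_congr rfl
  intro T hT
  rw [(Finset.mem_powersetCard.1 hT).2]
  congr 3
  omega

/-- For `n ≥ 4`, an integer `⌊n/2⌋ ≤ k ≤ n-2`, and `x` with
`0 < x_1 ≤ ⋯ ≤ x_n`, `x_k < x_{k+1} = ⋯ = x_n` and `x_n ≥ 1`, we have `S_k(x) > 0`
(the paper's `1`-indexed coordinate `x_j` is the `0`-indexed coordinate `j - 1`). -/
theorem S_k_pos (n : ℕ) (hn : 4 ≤ n) (k : ℕ) (hk1 : n / 2 ≤ k) (hk2 : k ≤ n - 2)
    (x : Fin n → ℝ)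
    (hpos : 0 < x ⟨0, by omega⟩) (hmono : Monotone x)
    (hlt : x ⟨k - 1, by omega⟩ < x ⟨k, by omega⟩)
    (heq : ∀ j : Fin n, k ≤ (j : ℕ) → x j = x ⟨n - 1, by omega⟩)
    (hge : 1 ≤ x ⟨n - 1, by omega⟩) :
    0 < Sfun n ⟨k - 1, by omega⟩ ⟨n - 1, by omega⟩ x := by
  have hne : (⟨k - 1, by omega⟩ : Fin n) ≠ ⟨n - 1, by omega⟩ := by
    intro h; rw [Fin.mk.injEq] at h; omega
  rw [Sfun_eq n hn _ _ hne, sub_pos]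
  set kk : Fin n := ⟨k - 1, by omega⟩ with hkk
  set ll : Fin n := ⟨n - 1, by omega⟩ with hll
  have hc : ((Finset.univ.erase kk).erase ll).card = n - 2 := by
    rw [Finset.card_erase_of_mem (by simp [hne.symm]), Finset.card_erase_of_mem (by simp)]
    simp; omega
  have h0U : (⟨0, by omega⟩ : Fin n) ∈ (Finset.univ.erase kk).erase ll := by
    simp [hkk, hll, Fin.ext_iff]; omega
  have hxpos : ∀ i, 0 < x i := fun i => lt_of_lt_of_le hpos (hmono (Fin.mk_le_of_le_val (Nat.zero_le _)))
  generalize ((Finset.univ.erase kk).erase ll) = U at hc h0U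
  rw [← hc]
  set A := U.filter (fun i : Fin n => (i : ℕ) < k) with hA
  set B := U.filter (fun i : Fin n => ¬ (i : ℕ) < k) with hB
  have h0A : (⟨0, by omega⟩ : Fin n) ∈ A := by
    rw [hA, Finset.mem_filter]; exact ⟨h0U, by simp; omega⟩
  have hcard : A.card + B.card = U.card := Finset.card_filter_add_card_filter_not _
  have hKpos : (0:ℝ) < A.card := by exact_mod_cast Finset.card_pos.2 ⟨_, h0A⟩
  set s := Real.sqrt (x kk)
  set t := Real.sqrt (x ll)
  have hs : 0 < s := Real.sqrt_pos.2 (hxpos _)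
  have ht1 : 1 ≤ t := Real.one_le_sqrt.2 hge
  have hst : s ≤ t := Real.sqrt_le_sqrt (hmono (by simp [hkk, hll]; omega))
  set lam := max s 1 with hlam
  have hl1 : 1 ≤ lam := le_max_right _ _
  have hls : s ≤ lam := le_max_left _ _
  have hlt' : lam ≤ t := max_le hst ht1
  have hl0 : 0 < lam := by linarith
  have hAs : ∀ i ∈ A, Real.sqrt (x i) ≤ s := by
    intro i hi
    have := (Finset.mem_filter.1 hi).2
    exact Real.sqrt_le_sqrt (hmono (by rw [hkk, Fin.le_def]; simp; omega))
  have hBx : ∀ i ∈ B, x i = x ll := by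
    intro i hi
    have := (Finset.mem_filter.1 hi).2
    exact heq i (by omega)
  let w : Fin n → ℝ := fun i => if (i : ℕ) < k then (Real.sqrt (x i) / lam) ^ 2 else 1
  have hw0 : ∀ i ∈ U, 0 ≤ w i := by
    intro i _; simp only [w]; split_ifs <;> positivity
  have hwA : ∀ i ∈ A, w i = (Real.sqrt (x i) / lam) ^ 2 := by
    intro i hi; simp only [w, (Finset.mem_filter.1 hi).2, if_true]
  have hwB : ∀ i ∈ B, w i = 1 := by
    intro i hi; simp only [w, (Finset.mem_filter.1 hi).2, if_false]
  have hw1 : ∀ i ∈ U, w i ≤ 1 := by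
    intro i hi
    by_cases h : (i : ℕ) < k
    · have hiA : i ∈ A := Finset.mem_filter.2 ⟨hi, h⟩
      rw [hwA i hiA]
      apply pow_le_one₀ (by positivity)
      rw [div_le_one hl0]
      exact (hAs i hiA).trans hls
    · rw [hwB i (Finset.mem_filter.2 ⟨hi, h⟩)]
  have hwx : ∀ i ∈ U, w i ≤ x i := by
    intro i hi
    by_cases h : (i : ℕ) < k
    · have hiA : i ∈ A := Finset.mem_filter.2 ⟨hi, h⟩
      rw [hwA i hiA, div_pow, Real.sq_sqrt (hxpos i).le]
      exact div_le_self (hxpos i).le (one_le_pow₀ hl1)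
    · have hiB : i ∈ B := Finset.mem_filter.2 ⟨hi, h⟩
      rw [hwB i hiB, hBx i hiB]; exact hge
  refine lt_of_lt_of_le ?_ (FF_mono U w x hw0 hwx 1)
  refine lt_of_lt_of_le ?_ (FF_lower U w hw0 hw1)
  apply mul_lt_mul_of_pos_left _ (by positivity)
  have hcR : (U.card : ℝ) = B.card + A.card := by rw [← hcard]; push_cast; ring
  set P := ∑ i ∈ A, Real.sqrt (x i) / lam with hP
  have hsum : ∑ i ∈ U, Real.sqrt (x i) / (s + t)
      = (B.card * (t / lam) + A.card * (P / A.card)) / (s / lam + t / lam) := by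
    rw [← Finset.sum_filter_add_sum_filter_not U (fun i : Fin n => (i : ℕ) < k), ← hA, ← hB,
      Finset.sum_congr rfl (fun i hi => by rw [hBx i hi] :
        ∀ i ∈ B, Real.sqrt (x i) / (s + t) = t / (s + t)),
      Finset.sum_const, nsmul_eq_mul, ← Finset.sum_div, hP, ← Finset.sum_div]
    have : 0 < s + t := by linarith
    field_simp
    ring
  have hZ : ∑ i ∈ U, (1 - w i) = A.card - ∑ i ∈ A, (Real.sqrt (x i) / lam) ^ 2 := by
    rw [← Finset.sum_filter_add_sum_filter_not U (fun i : Fin n => (i : ℕ) < k), ← hA, ← hB,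
      Finset.sum_eq_zero (s := B) (fun i hi => by rw [hwB i hi, sub_self]), add_zero,
      Finset.sum_congr rfl (fun i hi => by rw [hwA i hi] :
        ∀ i ∈ A, 1 - w i = 1 - (Real.sqrt (x i) / lam) ^ 2), Finset.sum_sub_distrib]
    simp
  rw [hsum, hZ, hcR]
  apply final_ineq
  · positivity
  · exact hKpos
  · apply div_pos _ hKpos
    exact Finset.sum_pos (fun i _ => div_pos (Real.sqrt_pos.2 (hxpos i)) hl0) ⟨_, h0A⟩
  · rw [div_le_iff₀ hKpos, mul_comm, ← nsmul_eq_mul]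
    exact Finset.sum_le_card_nsmul _ _ _ (fun i hi => div_le_div_of_nonneg_right (hAs i hi) hl0.le)
  · exact (div_le_one hl0).2 hls
  · exact (one_le_div hl0).2 hlt'
  · have := sq_sum_le_card_mul_sum_sq (s := A) (f := fun i => Real.sqrt (x i) / lam)
    rw [← hP] at this
    rw [div_pow, sq (A.card : ℝ), mul_div_assoc', mul_div_mul_left _ _ hKpos.ne',
      div_le_iff₀ hKpos]
    linarith
end
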